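/- arXiv:1802.06736 — 2 statements merged into one kernel-verified Lean document; each statement's English description precedes it below -/
import Mathlib

section
/- Let L be a complete filtered complex, λ ∈ F_1S^1(L,L), and h: L → L a filtered map of degree −1. Then for all y, y' ∈ F_1L^0 and all k ≥ 0, if y − y' ∈ F_kL then h(λ•y) − h(λ•y') ∈ F_{k+1}L, where λ•y := Σ_{n≥0} (1/n!) λ_n(y,…,y). Consequently, the map y ↦ −h(λ•y) is a contraction of F_1L^0 with Lipschitz constant c^{-1} with respect to the metric d_c, and for every a ∈ F_1L^0 the equation y = a − h(λ•y) has a unique solution y ∈ F_1L^0. -/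
/-!
Formalization infrastructure for Getzler, "Maurer–Cartan elements and homotopical
perturbation theory".

We fix a field `𝕜` of characteristic zero.  A *complete filtered complex* is a
ℤ-graded `𝕜`-vector space (presented as a vector space `V` with an internal grading
`gr : ℤ → Submodule 𝕜 V`) with a decreasing filtration `F : ℕ → Submodule 𝕜 V` by
graded subspaces, with `F 0 = ⊤`, separated (`⋂ F n = 0`) and complete (every fast
Cauchy sequence for the filtration has a limit) — this is completeness for the metric
`d_c(x,y) = inf { c^(-k) | x - y ∈ F k }` —, together with a filtration-preserving
differential `δ` of degree `1` with `δ² = 0`.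

`SElt L M i` formalizes the space `S^i(L,M) = F_1 M^i × ∏_{n ≥ 1} S^{n,i}(L,M)` of
inhomogeneous graded-symmetric filtered multilinear maps of degree `i`.

Since a multilinear map on an internally graded space is determined by its values on
homogeneous tuples, the operations `a ∘ b`, `a • b`, `a ∘_b β`, the differential
`δ a` on `S(L,M)`, and the sums `λ • x` of the Maurer–Cartan equation (which are
limits of partial sums in the complete filtered topology) are formalized as
*relations*, characterized by the defining formulas of the paper on homogeneous
tuples (with the appropriate Koszul signs).
-/

open scoped BigOperators

noncomputable section

namespace HPT

variable (𝕜 : Type) [Field 𝕜] [CharZero 𝕜]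

/-- A complete filtered ℤ-graded vector space over `𝕜`. -/
structure FilteredGraded where
  V : Type
  [acg : AddCommGroup V]
  [mod : Module 𝕜 V]
  /-- the grading -/
  gr : ℤ → Submodule 𝕜 V
  internal : DirectSum.IsInternal gr
  /-- the decreasing filtration `F 0 = L ⊇ F 1 ⊇ F 2 ⊇ ⋯` -/
  F : ℕ → Submodule 𝕜 V
  F_top : F 0 = ⊤
  F_anti : ∀ n : ℕ, F (n + 1) ≤ F n
  /-- the filtration is by graded subspaces -/
  F_graded : ∀ n : ℕ, F n = ⨆ i : ℤ, F n ⊓ gr i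
  /-- separatedness: the metric `d_c` is a genuine metric -/
  sep : ∀ x : V, (∀ n : ℕ, x ∈ F n) → x = 0
  /-- completeness with respect to the metric `d_c` -/
  complete : ∀ u : ℕ → V, (∀ m m' : ℕ, m ≤ m' → u m' - u m ∈ F m) →
    ∃ y : V, ∀ m : ℕ, y - u m ∈ F m

attribute [instance] FilteredGraded.acg FilteredGraded.mod

/-- A complete filtered complex: a complete filtered graded vector space together with
a filtration-preserving differential of degree `1` squaring to zero. -/
structure FilteredComplex extends FilteredGraded 𝕜 where
  δ : V →ₗ[𝕜] V
  δ_deg : ∀ (i : ℤ) (x : V), x ∈ gr i → δ x ∈ gr (i + 1)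
  δ_filt : ∀ (n : ℕ) (x : V), x ∈ F n → δ x ∈ F n
  δ_sq : ∀ x : V, δ (δ x) = 0

variable {𝕜}

/-- `y` is the limit of the sequence `u` with respect to the (complete) filtration `F`:
this is convergence for the metric `d_c`. -/
def IsFLim {V : Type} [AddCommGroup V] [Module 𝕜 V] (F : ℕ → Submodule 𝕜 V)
    (u : ℕ → V) (y : V) : Prop :=
  ∀ m : ℕ, ∃ N : ℕ, ∀ n : ℕ, N ≤ n → y - u n ∈ F m

/-- The distance function `d_c(x,y) = inf { c^(-k) | x - y ∈ F k }`. -/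
def fdist {V : Type} [AddCommGroup V] [Module 𝕜 V]
    (F : ℕ → Submodule 𝕜 V) (c : ℝ) (x y : V) : ℝ :=
  ⨅ p : {n : ℕ // x - y ∈ F n}, c ^ (-(p.1 : ℤ))

/-- The sign `(-1)^z` for `z : ℤ`. -/
def sgn (z : ℤ) : ℤˣ := (-1 : ℤˣ) ^ z

/-- The Koszul sign `(-1)^ε` of a permutation `σ` acting on elements of degrees `j`. -/
def koszulSign {n : ℕ} (j : Fin n → ℤ) (σ : Equiv.Perm (Fin n)) : ℤˣ :=
  ∏ p ∈ Finset.univ.filter (fun p : Fin n × Fin n => p.1 < p.2 ∧ σ p.2 < σ p.1),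
    (-1 : ℤˣ) ^ (j p.1 * j p.2)

/-- `a` is a filtered graded-symmetric `n`-linear map of degree `i`,
i.e. an element of `S^{n,i}(L,M)`. -/
def IsSMap (L M : FilteredComplex 𝕜) (n : ℕ) (i : ℤ)
    (a : MultilinearMap 𝕜 (fun _ : Fin n => L.V) M.V) : Prop :=
  (∀ (j : Fin n → ℤ) (x : Fin n → L.V), (∀ s, x s ∈ L.gr (j s)) →
      a x ∈ M.gr ((∑ s, j s) + i)) ∧
  (∀ (j : Fin n → ℤ) (x : Fin n → L.V), (∀ s, x s ∈ L.gr (j s)) →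
      ∀ σ : Equiv.Perm (Fin n),
        a (fun s => x (σ s)) = ((koszulSign j σ : ℤ) : 𝕜) • a x) ∧
  (∀ (κ : Fin n → ℕ) (x : Fin n → L.V), (∀ s, x s ∈ L.F (κ s)) →
      a x ∈ M.F (∑ s, κ s))

/-- `S^{n,i}(L,M)` as a submodule of the space of `n`-linear maps from `L` to `M`. -/
def SMapMod (L M : FilteredComplex 𝕜) (n : ℕ) (i : ℤ) :
    Submodule 𝕜 (MultilinearMap 𝕜 (fun _ : Fin n => L.V) M.V) where
  carrier := {a | IsSMap L M n i a}
  add_mem' := by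
    rintro a b ⟨ha1, ha2, ha3⟩ ⟨hb1, hb2, hb3⟩
    refine ⟨fun j x hx => ?_, fun j x hx σ => ?_, fun κ x hx => ?_⟩
    · simpa using Submodule.add_mem _ (ha1 j x hx) (hb1 j x hx)
    · simp only [MultilinearMap.add_apply, ha2 j x hx σ, hb2 j x hx σ, smul_add]
    · simpa using Submodule.add_mem _ (ha3 κ x hx) (hb3 κ x hx)
  zero_mem' := by
    refine ⟨fun j x hx => ?_, fun j x hx σ => ?_, fun κ x hx => ?_⟩
    · simp
    · simp
    · simp
  smul_mem' := by
    rintro c a ⟨ha1, ha2, ha3⟩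
    refine ⟨fun j x hx => ?_, fun j x hx σ => ?_, fun κ x hx => ?_⟩
    · simpa using Submodule.smul_mem _ c (ha1 j x hx)
    · simp only [MultilinearMap.smul_apply, ha2 j x hx σ]
      rw [smul_comm]
    · simpa using Submodule.smul_mem _ c (ha3 κ x hx)

/-- `S^i(L,M) = F_1 M^i × ∏_{n ≥ 1} S^{n,i}(L,M)`: a family of graded-symmetric filtered
multilinear maps, one in each arity, whose `0`-ary component (a constant) lies in `F_1 M`. -/
def SEltMod (L M : FilteredComplex 𝕜) (i : ℤ) :
    Submodule 𝕜 (∀ n : ℕ, SMapMod L M n i) where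
  carrier := {a | ((a 0).1 (fun s => s.elim0)) ∈ M.F 1}
  add_mem' := by
    intro a b ha hb
    simpa using Submodule.add_mem _ ha hb
  zero_mem' := by simp
  smul_mem' := by
    intro c a ha
    simpa using Submodule.smul_mem _ c ha

/-- The space `S^i(L,M)`. -/
abbrev SElt (L M : FilteredComplex 𝕜) (i : ℤ) : Type := ↥(SEltMod L M i)

/-- The `n`-ary component `a_n` of an element `a ∈ S^i(L,M)`. -/
def appS {L M : FilteredComplex 𝕜} {i : ℤ} (a : SElt L M i) (n : ℕ) :
    MultilinearMap 𝕜 (fun _ : Fin n => L.V) M.V :=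
  (a.1 n).1

/-- `a ∈ F_m S^i(L,M)`: the filtration on `S^i(L,M)`. -/
def memFS {L M : FilteredComplex 𝕜} {i : ℤ} (a : SElt L M i) (m : ℕ) : Prop :=
  ∀ (n : ℕ) (κ : Fin n → ℕ) (x : Fin n → L.V), (∀ s, x s ∈ L.F (κ s)) →
    appS a n x ∈ M.F ((∑ s, κ s) + m)

/-- `da = δ a`, the differential on `S(L,M)` induced by the differentials of `L` and `M`,
characterized on homogeneous tuples. -/
def IsDeriv {L M : FilteredComplex 𝕜} {i i' : ℤ} (a : SElt L M i) (da : SElt L M i') : Prop :=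
  ∀ (n : ℕ) (j : Fin n → ℤ) (x : Fin n → L.V), (∀ s, x s ∈ L.gr (j s)) →
    appS da n x = M.δ (appS a n x)
      - ((sgn i : ℤ) : 𝕜) • ∑ l : Fin n,
          ((sgn (∑ l' ∈ Finset.univ.filter (fun l' => l' < l), j l') : ℤ) : 𝕜) •
            appS a n (Function.update x l (L.δ (x l)))

/-- One term `a_{n-m+1}(b_m(x_{σ(1)},…,x_{σ(m)}), x_{σ(m+1)},…,x_{σ(n)})` of the
pre-Lie product `a ∘ b`. -/
def circTerm {L M : FilteredComplex 𝕜} {i j : ℤ} (a : SElt L M i) (b : SElt L L j)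
    (n m : ℕ) (hm : m ≤ n) (σ : Equiv.Perm (Fin n)) (x : Fin n → L.V) : M.V :=
  appS a (n - m + 1)
    (Fin.cons (appS b m (fun s => x (σ (Fin.castLE hm s))))
      (fun t : Fin (n - m) => x (σ ⟨m + t.1, by have := t.2; omega⟩)))

/-- `c = a ∘ b`, the pre-Lie product
`(a ∘ b)_n(x_1,…,x_n) = ∑_σ (-1)^ε ∑_{m=0}^n (1/(m!(n-m)!))
  a_{n-m+1}(b_m(x_{σ(1)},…),…,x_{σ(n)})`,
characterized on homogeneous tuples. -/
def IsCirc {L M : FilteredComplex 𝕜} {i j i' : ℤ}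
    (a : SElt L M i) (b : SElt L L j) (c : SElt L M i') : Prop :=
  ∀ (n : ℕ) (jd : Fin n → ℤ) (x : Fin n → L.V), (∀ s, x s ∈ L.gr (jd s)) →
    appS c n x = ∑ σ : Equiv.Perm (Fin n), ∑ m ∈ (Finset.range (n + 1)).attach,
      ((((Nat.factorial m.1 : 𝕜) * (Nat.factorial (n - m.1) : 𝕜))⁻¹) *
        ((koszulSign jd σ : ℤ) : 𝕜)) •
        circTerm a b n m.1 (by have := Finset.mem_range.mp m.2; omega) σ x

/-- The index in `Fin n` of the `s`-th input of the `t`-th block, for a decomposition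
of `n` inputs into blocks of sizes `d 0, …, d (m-1)`. -/
def blockIdx {n m : ℕ} (d : Fin m → ℕ) (hd : (∑ t, d t) = n) (t : Fin m) (s : Fin (d t)) :
    Fin n :=
  ⟨(∑ t' ∈ Finset.univ.filter (fun t' => t' < t), d t') + s.1, by
    have ht : t ∉ Finset.univ.filter (fun t' : Fin m => t' < t) := by simp
    have h1 : ∑ t' ∈ insert t (Finset.univ.filter (fun t' : Fin m => t' < t)), d t'
        ≤ ∑ t', d t' := Finset.sum_le_sum_of_subset (Finset.subset_univ _)
    rw [Finset.sum_insert ht] at h1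
    have h2 := s.2
    omega⟩

/-- One term `a_m(b_{n_1}(x_{σ(1)},…),…,b_{n_m}(…,x_{σ(n)}))` of the composition `a • b`. -/
def bulletTerm {K L M : FilteredComplex 𝕜} {i : ℤ} (a : SElt L M i) (b : SElt K L 0)
    {n m : ℕ} (d : Fin m → ℕ) (hd : (∑ t, d t) = n)
    (σ : Equiv.Perm (Fin n)) (x : Fin n → K.V) : M.V :=
  appS a m (fun t => appS b (d t) (fun s => x (σ (blockIdx d hd t s))))

/-- `c = a • b`, the composition
`(a • b)_n(x_1,…,x_n) = ∑_σ (-1)^ε ∑_k (1/k!) ∑_{n_1+⋯+n_k=n} (1/(n_1!⋯n_k!))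
  a_k(b_{n_1}(x_{σ(1)},…),…,b_{n_k}(…,x_{σ(n)}))`,
characterized on homogeneous tuples; the sum over `k` is infinite (blocks of size `0`
are inserted), and converges since `b_0 ∈ F_1 L`: each component of `a • b` is the limit
of the partial sums in the complete filtered space `M`. -/
def IsBullet {K L M : FilteredComplex 𝕜} {i i' : ℤ}
    (a : SElt L M i) (b : SElt K L 0) (c : SElt K M i') : Prop :=
  ∀ (n : ℕ) (jd : Fin n → ℤ) (x : Fin n → K.V), (∀ s, x s ∈ K.gr (jd s)) →
    IsFLim M.F
      (fun N => ∑ m ∈ Finset.range (N + 1), ∑ σ : Equiv.Perm (Fin n),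
        ∑ d ∈ (Finset.Nat.antidiagonalTuple m n).attach,
          ((((Nat.factorial m : 𝕜) * ∏ t, (Nat.factorial (d.1 t) : 𝕜))⁻¹) *
            ((koszulSign jd σ : ℤ) : 𝕜)) •
            bulletTerm a b d.1 (Finset.Nat.mem_antidiagonalTuple.mp d.2) σ x)
      (appS c n x)

/-- One term `a_{m+1}(β_{n_0}(…), b_{n_1}(…),…,b_{n_m}(…))` of `a ∘_b β`. -/
def circAtTerm {K L M : FilteredComplex 𝕜} {i : ℤ} (a : SElt L M i)
    (b : SElt K L 0) (β : SElt K L 1)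
    {n m : ℕ} (d : Fin (m + 1) → ℕ) (hd : (∑ t, d t) = n)
    (σ : Equiv.Perm (Fin n)) (x : Fin n → K.V) : M.V :=
  appS a (m + 1)
    (Fin.cons (appS β (d 0) (fun s => x (σ (blockIdx d hd 0 s))))
      (fun t : Fin m => appS b (d t.succ) (fun s => x (σ (blockIdx d hd t.succ s)))))

/-- `c = a ∘_b β`, the linearization of `a • b` in the direction `β`, defined by
`a • (b + β ε) = a • b + (a ∘_b β) ε` where `ε` is an exterior generator of degree `-1`;
explicitly, each term of `a • b` is replaced by the sum of the terms in which exactly one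
block `b_{n_j}` is replaced by `β_{n_j}` (placed first, using the symmetry of `a`),
characterized on homogeneous tuples, the infinite sum being a limit of partial sums. -/
def IsCircAt {K L M : FilteredComplex 𝕜} {i i' : ℤ}
    (a : SElt L M i) (b : SElt K L 0) (β : SElt K L 1) (c : SElt K M i') : Prop :=
  ∀ (n : ℕ) (jd : Fin n → ℤ) (x : Fin n → K.V), (∀ s, x s ∈ K.gr (jd s)) →
    IsFLim M.F
      (fun N => ∑ m ∈ Finset.range (N + 1), ∑ σ : Equiv.Perm (Fin n),
        ∑ d ∈ (Finset.Nat.antidiagonalTuple (m + 1) n).attach,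
          ((((Nat.factorial m : 𝕜) * ∏ t, (Nat.factorial (d.1 t) : 𝕜))⁻¹) *
            ((koszulSign jd σ : ℤ) : 𝕜)) •
            circAtTerm a b β d.1 (Finset.Nat.mem_antidiagonalTuple.mp d.2) σ x)
      (appS c n x)

/-- `z = a • y = a_0 + ∑_{n ≥ 1} (1/n!) a_n(y,…,y)`, the evaluation of `a ∈ S^i(K,M)` at a
point `y` of positive filtration degree; the series converges in the complete filtered
space `M`, and `z` is its limit. -/
def IsEvalBullet {K M : FilteredComplex 𝕜} {i : ℤ} (a : SElt K M i) (y : K.V) (z : M.V) :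
    Prop :=
  IsFLim M.F
    (fun N => ∑ n ∈ Finset.range (N + 1), ((Nat.factorial n : 𝕜))⁻¹ • appS a n (fun _ => y))
    z

/-- `x` is a Maurer–Cartan element of the curved `L∞`-algebra `(L, δ, lam)`:
`x ∈ F_1 L^0` and `δ x + lam • x = 0` where `lam • x = ∑_{n ≥ 0} (1/n!) lam_n(x,…,x)`. -/
def IsMC (L : FilteredComplex 𝕜) (lam : SElt L L 1) (x : L.V) : Prop :=
  x ∈ L.F 1 ∧ x ∈ L.gr 0 ∧ ∃ y : L.V, IsEvalBullet lam x y ∧ L.δ x + y = 0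

/-- `(L, δ, lam)` is a curved `L∞`-algebra: `δ lam + lam ∘ lam = 0`. -/
def IsCurved (L : FilteredComplex 𝕜) (lam : SElt L L 1) : Prop :=
  ∃ d q : SElt L L 2, IsDeriv lam d ∧ IsCirc lam lam q ∧ d + q = 0

/-- `c = φ ∘ a`: postcomposition of each component of `a` with the linear map `φ`. -/
def IsPostComp {K L L' : FilteredComplex 𝕜} {i i' : ℤ} (φ : L.V →ₗ[𝕜] L'.V)
    (a : SElt K L i) (c : SElt K L' i') : Prop :=
  ∀ (n : ℕ) (x : Fin n → K.V), appS c n x = φ (appS a n x)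

/-- `a` is the element of `S^0(M,L)` whose only nonzero component is the linear map
`f ∈ S^{1,0}(M,L)`. -/
def IsOfLin {M L : FilteredComplex 𝕜} (f : M.V →ₗ[𝕜] L.V) (a : SElt M L 0) : Prop :=
  (∀ x : Fin 1 → M.V, appS a 1 x = f (x 0)) ∧ ∀ n : ℕ, n ≠ 1 → appS a n = 0

/-- A homological perturbation theory context for `(L, δ)`: a complete filtered
complex `(M, d)`, filtered chain maps `f : M → L` and `g : L → M` with `g f = 1_M`, and a
filtered map `h : L → L` of degree `-1` with `1_L = f g + δ h + h δ`, satisfying the side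
conditions `h² = h f = g h = 0`. -/
structure PContext (L M : FilteredComplex 𝕜) where
  f : M.V →ₗ[𝕜] L.V
  g : L.V →ₗ[𝕜] M.V
  h : L.V →ₗ[𝕜] L.V
  f_deg : ∀ (i : ℤ) (x : M.V), x ∈ M.gr i → f x ∈ L.gr i
  f_filt : ∀ (n : ℕ) (x : M.V), x ∈ M.F n → f x ∈ L.F n
  f_chain : ∀ x : M.V, f (M.δ x) = L.δ (f x)
  g_deg : ∀ (i : ℤ) (x : L.V), x ∈ L.gr i → g x ∈ M.gr i
  g_filt : ∀ (n : ℕ) (x : L.V), x ∈ L.F n → g x ∈ M.F n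
  g_chain : ∀ x : L.V, g (L.δ x) = M.δ (g x)
  gf : ∀ x : M.V, g (f x) = x
  h_deg : ∀ (i : ℤ) (x : L.V), x ∈ L.gr i → h x ∈ L.gr (i - 1)
  h_filt : ∀ (n : ℕ) (x : L.V), x ∈ L.F n → h x ∈ L.F n
  homotopy : ∀ x : L.V, x = f (g x) + L.δ (h x) + h (L.δ x)
  hh : ∀ x : L.V, h (h x) = 0
  hf : ∀ x : M.V, h (f x) = 0
  gh : ∀ x : L.V, g (h x) = 0

/-- `F` solves Fukaya's fixed-point equation `F = f - h ∘ (lam • F)`. -/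
def IsFixedPointF {L M : FilteredComplex 𝕜} (lam : SElt L L 1) (P : PContext L M)
    (F : SElt M L 0) : Prop :=
  ∃ (fS hΛ : SElt M L 0) (Λ : SElt M L 1),
    IsOfLin P.f fS ∧ IsBullet lam F Λ ∧ IsPostComp P.h Λ hΛ ∧ F = fS - hΛ

/-- `μ = g ∘ (lam • F)`, the curved `L∞`-structure induced on `M`. -/
def IsMuOf {L M : FilteredComplex 𝕜} (lam : SElt L L 1) (P : PContext L M)
    (F : SElt M L 0) (μ : SElt M M 1) : Prop :=
  ∃ Λ : SElt M L 1, IsBullet lam F Λ ∧ IsPostComp P.g Λ μ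

/-- `φ` is an `L∞`-morphism from `(K, κ)` to `(M, μ)`: `δ φ + μ • φ = φ ∘ κ`. -/
def IsMorphism {K M : FilteredComplex 𝕜} (κ : SElt K K 1) (μ : SElt M M 1)
    (φ : SElt K M 0) : Prop :=
  ∃ dφ Ψ Φ : SElt K M 1, IsDeriv φ dφ ∧ IsBullet μ φ Ψ ∧ IsCirc φ κ Φ ∧ dφ + Ψ = Φ

end HPT
namespace HPT

namespace FilteredGraded

variable {𝕜 : Type} [Field 𝕜] (L : FilteredGraded 𝕜)

lemma F_antitone : Antitone L.F := antitone_nat_of_succ_le L.F_anti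

/-- The homogeneous components of an element of `F m` lie in `F m`. -/
lemma decompose_mem_F [DirectSum.Decomposition L.gr] {m : ℕ} {x : L.V} (hx : x ∈ L.F m) (j : ℤ) :
    (DirectSum.decompose L.gr x j : L.V) ∈ L.F m := by
  rw [L.F_graded m] at hx
  induction hx using Submodule.iSup_induction' with
  | mem i x hx =>
    by_cases hij : i = j
    · subst hij
      rw [DirectSum.decompose_of_mem_same _ hx.2]
      exact hx.1
    · rw [DirectSum.decompose_of_mem_ne _ hx.2 hij]
      exact zero_mem _
  | zero => simp
  | add x y _ _ hx hy =>
    rw [DirectSum.decompose_add]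
    exact add_mem hx hy

/-- Each graded piece is closed for the topology of the filtration. -/
lemma mem_gr_of_approx {i : ℤ} {x : L.V} (hx : ∀ m : ℕ, ∃ u ∈ L.gr i, x - u ∈ L.F m) :
    x ∈ L.gr i := by
  classical
  let := L.internal.chooseDecomposition
  have key : ∀ j, i ≠ j → (DirectSum.decompose L.gr x j : L.V) = 0 := fun j hij =>
    L.sep _ fun m => by
      obtain ⟨u, hu, hxu⟩ := hx m
      have := L.decompose_mem_F hxu j
      rwa [DirectSum.decompose_sub, DirectSum.sub_apply, Submodule.coe_sub,
        DirectSum.decompose_of_mem_ne _ hu hij, sub_zero] at this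
  have hxi : x = (DirectSum.decompose L.gr x i : L.V) := by
    apply (DirectSum.decompose L.gr).injective
    ext j
    by_cases hij : i = j
    · subst hij
      rw [DirectSum.decompose_of_mem_same _ (SetLike.coe_mem _)]
    · rw [key j hij, DirectSum.decompose_of_mem_ne _ (SetLike.coe_mem _) hij]
  rw [hxi]
  exact SetLike.coe_mem _

end FilteredGraded

section Evaluation

variable {𝕜 : Type} [Field 𝕜] {L M : FilteredComplex 𝕜} {i : ℤ}

/-- The `n`-th term of `a • y` has filtration degree `n + m` when `a ∈ F_m S(L,M)`. -/
lemma memFS.appS_const_mem {a : SElt L M i} {m : ℕ} (ha : memFS a m) {y : L.V}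
    (hy : y ∈ L.F 1) (n : ℕ) : appS a n (fun _ => y) ∈ M.F (n + m) := by
  simpa using ha n (fun _ => 1) (fun _ => y) (fun _ => hy)

lemma memFS.appS_sub_mem {a : SElt L M i} {m : ℕ} (ha : memFS a m) {y y' : L.V} {k : ℕ}
    (hk : y - y' ∈ L.F k) (n : ℕ) :
    appS a n (fun _ => y) - appS a n (fun _ => y') ∈ M.F (k + m) := by
  have hy : (fun _ : Fin n => y) = (fun _ => y - y') + (fun _ => y') := by
    ext s
    simp
  rw [hy, MultilinearMap.map_add_univ,
    ← Finset.add_sum_erase _ _ (Finset.mem_univ (∅ : Finset (Fin n))), Finset.piecewise_empty,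
    add_sub_cancel_left]
  refine Submodule.sum_mem _ fun s hs => ?_
  obtain ⟨t, ht⟩ := Finset.nonempty_iff_ne_empty.mpr (Finset.ne_of_mem_erase hs)
  refine M.F_antitone ?_ (ha n (fun l => if l ∈ s then k else 0) _ fun l => ?_)
  · have := Finset.single_le_sum (f := fun l => if l ∈ s then k else 0)
      (fun _ _ => Nat.zero_le _) (Finset.mem_univ t)
    simp only [ht, if_true] at this
    omega
  · by_cases hl : l ∈ s
    · simpa [hl] using hk
    · simp [hl, L.F_top]

lemma memFS.exists_isEvalBullet {a : SElt L M i} (ha : memFS a 0) {y : L.V} (hy : y ∈ L.F 1) :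
    ∃ z, IsEvalBullet a y z := by
  obtain ⟨z, hz⟩ := M.complete
    (fun N => ∑ n ∈ Finset.range N, ((Nat.factorial n : 𝕜))⁻¹ • appS a n (fun _ => y))
    (fun m m' hm => by
      rw [← Finset.sum_Ico_eq_sub _ hm]
      refine Submodule.sum_mem _ fun n hn => Submodule.smul_mem _ _ ?_
      exact M.F_antitone (Finset.mem_Ico.mp hn).1 (ha.appS_const_mem hy n))
  exact ⟨z, fun m => ⟨m, fun n hn => M.F_antitone (by omega) (hz (n + 1))⟩⟩

lemma IsEvalBullet.mem_gr {a : SElt L M i} {y : L.V} (hy : y ∈ L.gr 0) {z : M.V}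
    (hz : IsEvalBullet a y z) : z ∈ M.gr i := by
  refine M.mem_gr_of_approx fun m => ?_
  obtain ⟨N, hN⟩ := hz m
  refine ⟨_, Submodule.sum_mem _ fun n _ => Submodule.smul_mem _ _ ?_, hN N le_rfl⟩
  simpa [appS] using (a.1 n).2.1 (fun _ => 0) (fun _ => y) (fun _ => hy)

lemma IsEvalBullet.mem_F {a : SElt L M i} {m : ℕ} (ha : memFS a m) {y : L.V}
    (hy : y ∈ L.F 1) {z : M.V} (hz : IsEvalBullet a y z) : z ∈ M.F m := by
  obtain ⟨N, hN⟩ := hz m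
  refine (Submodule.sub_mem_iff_left _ (Submodule.sum_mem _ fun n _ =>
    Submodule.smul_mem _ _ ?_)).mp (hN N le_rfl)
  exact M.F_antitone (Nat.le_add_left m n) (ha.appS_const_mem hy n)

lemma IsEvalBullet.sub_mem_F {a : SElt L M i} {m : ℕ} (ha : memFS a m) {y y' : L.V} {k : ℕ}
    (hk : y - y' ∈ L.F k) {z z' : M.V} (hz : IsEvalBullet a y z) (hz' : IsEvalBullet a y' z') :
    z - z' ∈ M.F (k + m) := by
  obtain ⟨N, hN⟩ := hz (k + m)
  obtain ⟨N', hN'⟩ := hz' (k + m)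
  have h₁ := hN (max N N') (le_max_left _ _)
  have h₂ := hN' (max N N') (le_max_right _ _)
  have h₃ := sub_mem h₁ h₂
  rw [sub_sub_sub_comm, ← Finset.sum_sub_distrib] at h₃
  refine (Submodule.sub_mem_iff_left _ (Submodule.sum_mem _ fun n _ => ?_)).mp h₃
  rw [← smul_sub]
  exact Submodule.smul_mem _ _ (ha.appS_sub_mem hk n)

end Evaluation

/-- A map raising the filtration degree of differences by one contracts `fdist` by `c⁻¹`. -/
lemma fdist_le_inv_mul_fdist {𝕜 V W : Type} [Field 𝕜] [AddCommGroup V] [Module 𝕜 V]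
    [AddCommGroup W] [Module 𝕜 W] {F : ℕ → Submodule 𝕜 V} {G : ℕ → Submodule 𝕜 W} {c : ℝ}
    (hc : 0 < c) (hF : F 0 = ⊤) {x y : V} {x' y' : W}
    (h : ∀ k, x - y ∈ F k → x' - y' ∈ G (k + 1)) :
    fdist G c x' y' ≤ c⁻¹ * fdist F c x y := by
  have : Nonempty {n : ℕ // x - y ∈ F n} := ⟨⟨0, by simp [hF]⟩⟩
  unfold fdist
  rw [Real.mul_iInf_of_nonneg (inv_nonneg.mpr hc.le)]
  refine le_ciInf fun p => ?_
  refine (ciInf_le ⟨0, ?_⟩ (⟨p.1 + 1, h p.1 p.2⟩ : {n : ℕ // x' - y' ∈ G n})).trans_eq ?_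
  · rintro _ ⟨q, rfl⟩
    positivity
  · rw [← zpow_neg_one, ← zpow_add₀ hc.ne']
    congr 1
    push_cast
    ring

/-- The contraction principle for a subset of a complete filtered space that is closed under
limits of fast Cauchy sequences. -/
lemma FilteredGraded.existsUnique_fixedPoint {𝕜 : Type} [Field 𝕜]
    (L : FilteredGraded 𝕜) {S : Set L.V}
    (hS : ∀ (u : ℕ → L.V) (y : L.V), (∀ n, u n ∈ S) → (∀ m, y - u m ∈ L.F m) → y ∈ S)
    (hne : S.Nonempty) (T : L.V → L.V) (hT : ∀ y ∈ S, T y ∈ S)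
    (hcontr : ∀ y ∈ S, ∀ y' ∈ S, ∀ k, y - y' ∈ L.F k → T y - T y' ∈ L.F (k + 1)) :
    ∃! y, y ∈ S ∧ y = T y := by
  obtain ⟨a, ha⟩ := hne
  have hmem : ∀ n, T^[n] a ∈ S := fun n => by
    induction n with
    | zero => exact ha
    | succ n ih => rw [Function.iterate_succ_apply']; exact hT _ ih
  have hstep : ∀ m n, T^[m + n] a - T^[m] a ∈ L.F m := fun m n => by
    induction m with
    | zero => simp [L.F_top]
    | succ m ih =>
      rw [Nat.add_right_comm, Function.iterate_succ_apply', Function.iterate_succ_apply']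
      exact hcontr _ (hmem _) _ (hmem _) _ ih
  obtain ⟨y, hy⟩ := L.complete (fun n => T^[n] a) fun m m' hm => by
    obtain ⟨n, rfl⟩ := Nat.exists_eq_add_of_le hm
    exact hstep m n
  have hyS : y ∈ S := hS _ y hmem hy
  have hyT : y = T y := by
    refine sub_eq_zero.mp (L.sep _ fun m => ?_)
    have h₁ := hy (m + 1)
    have h₂ := hcontr _ (hmem m) _ hyS m (by rw [← neg_sub]; exact neg_mem (hy m))
    rw [← Function.iterate_succ_apply' T] at h₂
    have h₃ := add_mem h₁ h₂
    rw [sub_add_sub_cancel] at h₃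
    exact L.F_anti m h₃
  refine ⟨y, ⟨hyS, hyT⟩, ?_⟩
  rintro y' ⟨hyS', hyT'⟩
  refine sub_eq_zero.mp (L.sep _ fun m => ?_)
  induction m with
  | zero => simp [L.F_top]
  | succ m ih =>
    rw [hyT', hyT]
    exact hcontr _ hyS' _ hyS _ ih

/-- Let `L` be a complete filtered complex, `lam ∈ F_1 S^1(L,L)` and
`h : L → L` a filtered map of degree `-1`.  Then for `y, y' ∈ F_1 L^0` with
`y - y' ∈ F_k L` one has `h(lam•y) - h(lam•y') ∈ F_{k+1} L`; consequently
`y ↦ -h(lam•y)` is a contraction of `F_1 L^0` with Lipschitz constant `c⁻¹` for the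
metric `d_c`, and for each `a ∈ F_1 L^0` the equation `y = a - h(lam•y)` has a unique
solution `y ∈ F_1 L^0`. -/
theorem statement16 (𝕜 : Type) [Field 𝕜] [CharZero 𝕜] (c : ℝ) (hc : 1 < c)
    (L : FilteredComplex 𝕜)
    (lam : SElt L L 1) (hpro : memFS lam 1)
    (h : L.V →ₗ[𝕜] L.V)
    (h_deg : ∀ (i : ℤ) (x : L.V), x ∈ L.gr i → h x ∈ L.gr (i - 1))
    (h_filt : ∀ (n : ℕ) (x : L.V), x ∈ L.F n → h x ∈ L.F n) :
    (∀ y y' : L.V, y ∈ L.F 1 → y ∈ L.gr 0 → y' ∈ L.F 1 → y' ∈ L.gr 0 →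
      ∀ k : ℕ, y - y' ∈ L.F k →
      ∀ zy zy' : L.V, IsEvalBullet lam y zy → IsEvalBullet lam y' zy' →
        h zy - h zy' ∈ L.F (k + 1)) ∧
    (∀ y y' : L.V, y ∈ L.F 1 → y ∈ L.gr 0 → y' ∈ L.F 1 → y' ∈ L.gr 0 →
      ∀ zy zy' : L.V, IsEvalBullet lam y zy → IsEvalBullet lam y' zy' →
        fdist L.F c (-(h zy)) (-(h zy')) ≤ c⁻¹ * fdist L.F c y y') ∧
    (∀ a : L.V, a ∈ L.F 1 → a ∈ L.gr 0 →
      ∃! y : L.V, y ∈ L.F 1 ∧ y ∈ L.gr 0 ∧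
        ∃ z : L.V, IsEvalBullet lam y z ∧ y = a - h z) := by
  have hsub : ∀ y y' : L.V, ∀ k : ℕ, y - y' ∈ L.F k → ∀ z z' : L.V,
      IsEvalBullet lam y z → IsEvalBullet lam y' z' → h z - h z' ∈ L.F (k + 1) := by
    intro y y' k hk z z' hz hz'
    rw [← map_sub]
    exact h_filt _ _ (hz.sub_mem_F hpro hk hz')
  refine ⟨fun y y' _ _ _ _ => hsub y y', fun y y' _ _ _ _ z z' hz hz' => ?_,
    fun a ha ha₀ => ?_⟩
  · refine fdist_le_inv_mul_fdist (by linarith) L.F_top fun k hk => ?_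
    rw [neg_sub_neg, ← neg_sub]
    exact neg_mem (hsub y y' k hk z z' hz hz')
  · have hpro₀ : memFS lam 0 := fun n κ x hx => L.F_anti _ (hpro n κ x hx)
    choose! E hE using fun (y : L.V) (hy : y ∈ L.F 1) => hpro₀.exists_isEvalBullet hy
    have hfix := L.existsUnique_fixedPoint (S := {y | y ∈ L.F 1 ∧ y ∈ L.gr 0})
      (fun u y hu hy => ⟨(Submodule.sub_mem_iff_left _ (hu 1).1).mp (hy 1),
        L.mem_gr_of_approx fun m => ⟨u m, (hu m).2, hy m⟩⟩)
      ⟨a, ha, ha₀⟩ (fun y => a - h (E y))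
      (fun y hy => ⟨sub_mem ha (h_filt _ _ ((hE y hy.1).mem_F hpro hy.1)),
        sub_mem ha₀ (h_deg 1 _ ((hE y hy.1).mem_gr hy.2))⟩)
      (fun y hy y' hy' k hk => by
        rw [sub_sub_sub_cancel_left, ← neg_sub]
        exact neg_mem (hsub y y' k hk _ _ (hE y hy.1) (hE y' hy'.1)))
    obtain ⟨y, ⟨⟨hy, hy₀⟩, hyT⟩, huniq⟩ := hfix
    refine ⟨y, ⟨hy, hy₀, E y, hE y hy, hyT⟩, ?_⟩
    rintro y' ⟨hy', hy₀', z, hz, hyz⟩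
    refine huniq y' ⟨⟨hy', hy₀'⟩, ?_⟩
    have hhz : h z = h (E y') := sub_eq_zero.mp <| L.sep _ fun m =>
      L.F_anti m (hsub y' y' m (by simp) _ _ hz (hE y' hy'))
    rw [← hhz]
    exact hyz

end HPT
end
end

section
/- Let (V,δ) and (W,d) be complete filtered complexes, let f: W → V and g: V → W be filtered chain maps with gf = 1_W, and let h: V → V be a filtered map of degree −1 with 1_V = fg + δh + hδ and the side conditions h² = hf = gh = 0. Let μ: V → V be a filtered map of degree 1 with μ(F_kV) ⊆ F_{k+1}V for all k, such that δ_μ := δ + μ satisfies δ_μ² = 0. Then the series h_μ = Σ_{n≥0} (−hμ)^n h, f_μ = Σ_{n≥0} (−hμ)^n f, g_μ = Σ_{n≥0} g(−μh)^n, and d_μ = d + Σ_{n≥0} g(−μh)^n μ f converge, and the deformed data again form a context: d_μ² = 0, f_μ and g_μ are filtered chain maps between (W,d_μ) and (V,δ_μ), g_μ f_μ = 1_W, 1_V = f_μ g_μ + δ_μ h_μ + h_μ δ_μ, and h_μ² = h_μ f_μ = g_μ h_μ = 0. -/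
/-!
Formalization infrastructure for Getzler, "Maurer–Cartan elements and homotopical
perturbation theory".

We fix a field `𝕜` of characteristic zero.  A *complete filtered complex* is a
ℤ-graded `𝕜`-vector space (presented as a vector space `V` with an internal grading
`gr : ℤ → Submodule 𝕜 V`) with a decreasing filtration `F : ℕ → Submodule 𝕜 V` by
graded subspaces, with `F 0 = ⊤`, separated (`⋂ F n = 0`) and complete (every fast
Cauchy sequence for the filtration has a limit) — this is completeness for the metric
`d_c(x,y) = inf { c^(-k) | x - y ∈ F k }` —, together with a filtration-preserving
differential `δ` of degree `1` with `δ² = 0`.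

`SElt L M i` formalizes the space `S^i(L,M) = F_1 M^i × ∏_{n ≥ 1} S^{n,i}(L,M)` of
inhomogeneous graded-symmetric filtered multilinear maps of degree `i`.

Since a multilinear map on an internally graded space is determined by its values on
homogeneous tuples, the operations `a ∘ b`, `a • b`, `a ∘_b β`, the differential
`δ a` on `S(L,M)`, and the sums `λ • x` of the Maurer–Cartan equation (which are
limits of partial sums in the complete filtered topology) are formalized as
*relations*, characterized by the defining formulas of the paper on homogeneous
tuples (with the appropriate Koszul signs).
-/

open scoped BigOperators

noncomputable section

namespace HPT

section FilteredGraded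

variable {𝕜 : Type} [Field 𝕜]

lemma FilteredGraded.F_antitone_s17 (L : FilteredGraded 𝕜) : Antitone L.F :=
  antitone_nat_of_succ_le L.F_anti

/-- Each graded piece is closed, since the filtration is by graded subspaces. -/
lemma FilteredGraded.mem_gr_of_isFLim (L : FilteredGraded 𝕜) {i : ℤ} {u : ℕ → L.V} {y : L.V}
    (hu : ∀ n, u n ∈ L.gr i) (hy : IsFLim L.F u y) : y ∈ L.gr i := by
  classical
  let _ : DirectSum.Decomposition L.gr := L.internal.chooseDecomposition
  have component_mem : ∀ (m : ℕ) (j : ℤ) (x : L.V), x ∈ L.F m →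
      (DirectSum.decompose L.gr x j : L.V) ∈ L.F m := by
    intro m j x hx
    rw [L.F_graded m] at hx
    induction hx using Submodule.iSup_induction' with
    | mem k x hx =>
      by_cases hkj : k = j
      · subst hkj
        rw [DirectSum.decompose_of_mem_same _ hx.2]
        exact hx.1
      · rw [DirectSum.decompose_of_mem_ne _ hx.2 hkj]
        exact zero_mem _
    | zero => simp
    | add x y _ _ hx hy =>
      rw [DirectSum.decompose_add]
      exact add_mem hx hy
  have component_eq_zero : ∀ j : ℤ, j ≠ i → (DirectSum.decompose L.gr y j : L.V) = 0 := by
    intro j hj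
    refine L.sep _ fun m => ?_
    obtain ⟨N, hN⟩ := hy m
    have h := component_mem m j _ (hN N le_rfl)
    rw [DirectSum.decompose_sub] at h
    simpa [DirectSum.decompose_of_mem_ne L.gr (hu N) hj.symm] using h
  have hy_eq : y = (DirectSum.decompose L.gr y i : L.V) := by
    conv_lhs => rw [← DirectSum.sum_support_decompose L.gr y]
    refine Finset.sum_eq_single i (fun j _ hj => component_eq_zero j hj) fun h => ?_
    simpa using h
  rw [hy_eq]
  exact SetLike.coe_mem _

lemma IsFLim.map {L M : FilteredGraded 𝕜} (φ : L.V →ₗ[𝕜] M.V)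
    (hφ : ∀ (n : ℕ) (x : L.V), x ∈ L.F n → φ x ∈ M.F n) {u : ℕ → L.V} {y : L.V}
    (hy : IsFLim L.F u y) : IsFLim M.F (fun n => φ (u n)) (φ y) := by
  intro m
  obtain ⟨N, hN⟩ := hy m
  refine ⟨N, fun n hn => ?_⟩
  rw [← map_sub]
  exact hφ _ _ (hN n hn)

lemma FilteredGraded.pow_mem_F (L : FilteredGraded 𝕜) {T : L.V →ₗ[𝕜] L.V}
    (hT : ∀ (n : ℕ) (x : L.V), x ∈ L.F n → T x ∈ L.F (n + 1)) (m n : ℕ) {x : L.V}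
    (hx : x ∈ L.F n) : (T ^ m) x ∈ L.F (n + m) := by
  induction m with
  | zero => simpa using hx
  | succ m ih =>
    rw [pow_succ', Module.End.mul_apply]
    exact hT _ _ ih

/-- The geometric series of an endomorphism strictly raising the filtration converges to an
inverse of `1 - T`. -/
lemma FilteredGraded.exists_geometric_sum (L : FilteredGraded 𝕜) (T : L.V →ₗ[𝕜] L.V)
    (hT : ∀ (n : ℕ) (x : L.V), x ∈ L.F n → T x ∈ L.F (n + 1)) :
    ∃ S : L.V →ₗ[𝕜] L.V,
      (∀ x, IsFLim L.F (fun N => ∑ n ∈ Finset.range (N + 1), (T ^ n) x) (S x)) ∧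
      (∀ x, S x - T (S x) = x) ∧ (∀ x, S (x - T x) = x) ∧
      (∀ (n : ℕ) (x : L.V), x ∈ L.F n → S x ∈ L.F n) := by
  have mem_zero : ∀ x : L.V, x ∈ L.F 0 := fun x => by simp [L.F_top]
  have tail : ∀ (x : L.V) (m m' : ℕ), m ≤ m' →
      ∑ n ∈ Finset.range m', (T ^ n) x - ∑ n ∈ Finset.range m, (T ^ n) x ∈ L.F m := by
    intro x m m' hm
    rw [← Finset.sum_Ico_eq_sub _ hm]
    refine sum_mem fun n hn => L.F_antitone_s17 (Finset.mem_Ico.mp hn).1 ?_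
    simpa using L.pow_mem_F hT n 0 (mem_zero x)
  have exists_sol : ∀ x : L.V, ∃ y : L.V,
      (∀ m, y - ∑ n ∈ Finset.range m, (T ^ n) x ∈ L.F m) ∧ y - T y = x := by
    intro x
    obtain ⟨y, hy⟩ := L.complete (fun m => ∑ n ∈ Finset.range m, (T ^ n) x) (tail x)
    refine ⟨y, hy, sub_eq_zero.mp (L.sep _ fun m => ?_)⟩
    have h := L.F_anti m (sub_mem (hy (m + 1)) (hT m _ (hy m)))
    convert h using 1
    rw [Finset.sum_range_succ', map_sub, map_sum]
    simp only [pow_succ', Module.End.mul_apply, pow_zero, Module.End.one_apply]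
    abel
  have inj : Function.Injective (1 - T : L.V →ₗ[𝕜] L.V) := by
    refine (injective_iff_map_eq_zero _).mpr fun x hx => L.sep x fun m => ?_
    have hx' : T x = x := (sub_eq_zero.mp hx).symm
    induction m with
    | zero => exact mem_zero x
    | succ m ih => exact hx' ▸ hT m x ih
  have surj : Function.Surjective (1 - T : L.V →ₗ[𝕜] L.V) := fun x =>
    let ⟨y, _, hy⟩ := exists_sol x
    ⟨y, by simpa using hy⟩
  let e := LinearEquiv.ofBijective (1 - T) ⟨inj, surj⟩
  have approx : ∀ x m, e.symm x - ∑ n ∈ Finset.range m, (T ^ n) x ∈ L.F m := by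
    intro x m
    obtain ⟨y, hy, hyx⟩ := exists_sol x
    have : e.symm x = y := by
      rw [LinearEquiv.symm_apply_eq]
      exact hyx.symm
    exact this ▸ hy m
  refine ⟨e.symm, fun x m => ⟨m, fun n hn => ?_⟩, fun x => ?_, fun x => ?_, fun n x hx => ?_⟩
  · exact L.F_antitone_s17 (by omega) (approx x (n + 1))
  · exact e.apply_symm_apply x
  · exact e.symm_apply_apply x
  · change e.symm x ∈ L.F n
    rw [← sub_add_cancel (e.symm x) (∑ k ∈ Finset.range n, (T ^ k) x)]
    exact add_mem (approx x n) (sum_mem fun k _ =>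
      L.F_antitone_s17 (Nat.le_add_right n k) (L.pow_mem_F hT k n hx))

end FilteredGraded

/-- homological perturbation lemma.  Given a context
`f : (W,d) ⇄ (V,δ) : g`, `h`, and a perturbation `μ : V → V` of degree `1` strictly
raising the filtration with `(δ+μ)² = 0`, the series
`h_μ = ∑ (-hμ)^n h`, `f_μ = ∑ (-hμ)^n f`, `g_μ = ∑ g(-μh)^n`,
`d_μ = d + ∑ g(-μh)^n μ f` converge, and the deformed data again form a context for
`δ_μ = δ + μ`.  Here `V = L` and `W = M`. -/
theorem statement17 (𝕜 : Type) [Field 𝕜] [CharZero 𝕜] (L M : FilteredComplex 𝕜)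
    (P : PContext L M)
    (μ : L.V →ₗ[𝕜] L.V)
    (μ_deg : ∀ (i : ℤ) (x : L.V), x ∈ L.gr i → μ x ∈ L.gr (i + 1))
    (μ_filt : ∀ (n : ℕ) (x : L.V), x ∈ L.F n → μ x ∈ L.F (n + 1))
    (hδμ : ∀ x : L.V, (L.δ + μ) ((L.δ + μ) x) = 0) :
    ∃ (Hμ : L.V →ₗ[𝕜] L.V) (Fμ : M.V →ₗ[𝕜] L.V) (Gμ : L.V →ₗ[𝕜] M.V)
      (Dμ : M.V →ₗ[𝕜] M.V),
      (∀ x : L.V, IsFLim L.F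
        (fun N => ∑ n ∈ Finset.range (N + 1), ((-(P.h ∘ₗ μ)) ^ n) (P.h x)) (Hμ x)) ∧
      (∀ x : M.V, IsFLim L.F
        (fun N => ∑ n ∈ Finset.range (N + 1), ((-(P.h ∘ₗ μ)) ^ n) (P.f x)) (Fμ x)) ∧
      (∀ x : L.V, IsFLim M.F
        (fun N => ∑ n ∈ Finset.range (N + 1), P.g (((-(μ ∘ₗ P.h)) ^ n) x)) (Gμ x)) ∧
      (∀ x : M.V, IsFLim M.F
        (fun N => M.δ x + ∑ n ∈ Finset.range (N + 1),
          P.g (((-(μ ∘ₗ P.h)) ^ n) (μ (P.f x)))) (Dμ x)) ∧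
      (∀ (i : ℤ) (x : M.V), x ∈ M.gr i → Dμ x ∈ M.gr (i + 1)) ∧
      (∀ (n : ℕ) (x : M.V), x ∈ M.F n → Dμ x ∈ M.F n) ∧
      (∀ x : M.V, Dμ (Dμ x) = 0) ∧
      (∀ (i : ℤ) (x : M.V), x ∈ M.gr i → Fμ x ∈ L.gr i) ∧
      (∀ (n : ℕ) (x : M.V), x ∈ M.F n → Fμ x ∈ L.F n) ∧
      (∀ x : M.V, Fμ (Dμ x) = (L.δ + μ) (Fμ x)) ∧
      (∀ (i : ℤ) (x : L.V), x ∈ L.gr i → Gμ x ∈ M.gr i) ∧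
      (∀ (n : ℕ) (x : L.V), x ∈ L.F n → Gμ x ∈ M.F n) ∧
      (∀ x : L.V, Gμ ((L.δ + μ) x) = Dμ (Gμ x)) ∧
      (∀ x : M.V, Gμ (Fμ x) = x) ∧
      (∀ x : L.V, x = Fμ (Gμ x) + (L.δ + μ) (Hμ x) + Hμ ((L.δ + μ) x)) ∧
      (∀ (i : ℤ) (x : L.V), x ∈ L.gr i → Hμ x ∈ L.gr (i - 1)) ∧
      (∀ (n : ℕ) (x : L.V), x ∈ L.F n → Hμ x ∈ L.F n) ∧
      (∀ x : L.V, Hμ (Hμ x) = 0) ∧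
      (∀ x : M.V, Hμ (Fμ x) = 0) ∧
      (∀ x : L.V, Gμ (Hμ x) = 0) := by
  have hμ_deg : ∀ (i : ℤ) (x : L.V), x ∈ L.gr i → P.h (μ x) ∈ L.gr i := fun i x hx => by
    simpa using P.h_deg _ _ (μ_deg _ _ hx)
  obtain ⟨A, A_lim, A_right, A_left, A_filt⟩ := L.exists_geometric_sum (-(P.h ∘ₗ μ))
    fun n x hx => neg_mem (P.h_filt _ _ (μ_filt n x hx))
  obtain ⟨B, B_lim, B_right, B_left, B_filt⟩ := L.exists_geometric_sum (-(μ ∘ₗ P.h))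
    fun n x hx => neg_mem (μ_filt _ _ (P.h_filt n x hx))
  simp only [LinearMap.neg_apply, LinearMap.comp_apply, sub_neg_eq_add, map_add]
    at A_right A_left B_right B_left
  have A_deg : ∀ (i : ℤ) (x : L.V), x ∈ L.gr i → A x ∈ L.gr i := by
    intro i x hx
    have pow_deg : ∀ n : ℕ, ((-(P.h ∘ₗ μ)) ^ n) x ∈ L.gr i := fun n => by
      induction n with
      | zero => simpa using hx
      | succ n ih =>
        rw [pow_succ', Module.End.mul_apply]
        exact neg_mem (hμ_deg _ _ ih)
    exact L.mem_gr_of_isFLim (fun N => sum_mem fun n _ => pow_deg n) (A_lim x)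
  obtain ⟨X, hX⟩ : ∃ X : L.V →ₗ[𝕜] L.V, X = μ ∘ₗ A := ⟨_, rfl⟩
  have X_apply : ∀ x, X x = μ (A x) := fun x => by rw [hX, LinearMap.comp_apply]
  have X_filt : ∀ (n : ℕ) (x : L.V), x ∈ L.F n → X x ∈ L.F n := fun n x hx => by
    rw [X_apply]
    exact L.F_anti n (μ_filt n _ (A_filt n x hx))
  have X_deg : ∀ (i : ℤ) (x : L.V), x ∈ L.gr i → X x ∈ L.gr (i + 1) := fun i x hx => by
    rw [X_apply]
    exact μ_deg i _ (A_deg i x hx)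
  have A_eq : ∀ x, A x = x - P.h (X x) := fun x => by
    rw [X_apply]
    exact eq_sub_of_add_eq (A_right x)
  have X_right : ∀ x, X x + μ (P.h (X x)) = μ x := fun x => by
    rw [X_apply, ← map_add, A_right]
  have X_left : ∀ x, X x + X (P.h (μ x)) = μ x := fun x => by
    rw [X_apply, X_apply, ← map_add, A_left]
  have X_eq : ∀ x, X x = B (μ x) := fun x => by
    rw [← X_right x, map_add, B_left]
  have B_eq : ∀ x, B x = x - X (P.h x) := fun x => by
    rw [X_eq]
    exact eq_sub_of_add_eq (B_left x)
  have X_sq : ∀ x, X (P.f (P.g (X x))) = -(L.δ (X x)) - X (L.δ x) := by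
    intro x
    have B_inj : ∀ z : L.V, z + μ (P.h z) = 0 → z = 0 := fun z hz => by
      rw [← B_left z, ← map_add, hz, map_zero]
    have r := X_right (L.δ x)
    have r' := X_right (P.f (P.g (X x)))
    have a := congrArg (fun z => μ (L.δ z)) (A_right x)
    have e := congrArg μ (P.homotopy (X x))
    have sq := hδμ (A x)
    have key := B_inj (X (P.f (P.g (X x))) + L.δ (X x) + X (L.δ x)) (by
      simp only [LinearMap.add_apply, map_add, X_apply, L.δ_sq] at r r' a e sq ⊢
      linear_combination (norm := module) r + r' - a - e + sq)
    linear_combination (norm := module) key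
  refine ⟨P.h - P.h ∘ₗ X ∘ₗ P.h, P.f - P.h ∘ₗ X ∘ₗ P.f, P.g - P.g ∘ₗ X ∘ₗ P.h,
    M.δ + P.g ∘ₗ X ∘ₗ P.f, fun x => ?_, fun x => ?_, fun x => ?_, fun x => ?_, ?_⟩
  · simpa [A_eq] using A_lim (P.h x)
  · simpa [A_eq] using A_lim (P.f x)
  · simpa [B_eq] using IsFLim.map P.g P.g_filt (B_lim x)
  · have h := IsFLim.map P.g P.g_filt (B_lim (μ (P.f x)))
    rw [← X_eq] at h
    intro m
    obtain ⟨N, hN⟩ := h m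
    exact ⟨N, fun n hn => by simpa using hN n hn⟩
  simp only [LinearMap.sub_apply, LinearMap.add_apply, LinearMap.comp_apply]
  refine ⟨fun i x hx => add_mem (M.δ_deg i x hx) (P.g_deg _ _ (X_deg _ _ (P.f_deg i x hx))),
    fun n x hx => add_mem (M.δ_filt n x hx) (P.g_filt _ _ (X_filt _ _ (P.f_filt n x hx))),
    fun x => ?_,
    fun i x hx => sub_mem (P.f_deg i x hx)
      (by simpa using P.h_deg _ _ (X_deg _ _ (P.f_deg i x hx))),
    fun n x hx => sub_mem (P.f_filt n x hx) (P.h_filt _ _ (X_filt _ _ (P.f_filt n x hx))),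
    fun x => ?_,
    fun i x hx => sub_mem (P.g_deg i x hx)
      (P.g_deg _ _ (by simpa using X_deg _ _ (P.h_deg i x hx))),
    fun n x hx => sub_mem (P.g_filt n x hx) (P.g_filt _ _ (X_filt _ _ (P.h_filt n x hx))),
    fun x => ?_, fun x => ?_, fun x => ?_,
    fun i x hx => sub_mem (P.h_deg i x hx)
      (P.h_deg _ _ (by simpa using X_deg _ _ (P.h_deg i x hx))),
    fun n x hx => sub_mem (P.h_filt n x hx) (P.h_filt _ _ (X_filt _ _ (P.h_filt n x hx))),
    fun x => ?_, fun x => ?_, fun x => ?_⟩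
  · simp only [map_add, M.δ_sq, X_sq, P.f_chain, map_sub, map_neg, P.g_chain]
    abel
  · have e := P.homotopy (X (P.f x))
    have r := X_right (P.f x)
    simp only [map_add, map_sub, map_neg, X_sq, P.f_chain]
    linear_combination (norm := module) r - e
  · have e := congrArg (fun y => P.g (X y)) (P.homotopy x)
    have r := congrArg P.g (X_left x)
    simp only [map_add, map_sub, map_neg, X_sq, P.g_chain] at e r ⊢
    linear_combination (norm := module) e - r
  · simp [P.gf, P.gh, P.hh, P.hf]
  · have e := P.homotopy (X (P.h x))
    have e' := congrArg (fun y => P.h (X y)) (P.homotopy x)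
    have r := X_right (P.h x)
    have r' := congrArg P.h (X_left x)
    have e0 := P.homotopy x
    simp only [map_add, map_sub, map_neg, X_sq] at e e' r r' ⊢
    linear_combination (norm := module) e0 - e - e' + r + r'
  · simp [P.hh]
  · simp [P.hh, P.hf]
  · simp [P.gh, P.hh]

end HPT
end
end
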